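/- Let K_1 ⊆ K_2 ⊆ ⋯ ⊆ K_n ⊆ F_q be subfields of F_q with |K_i| = d_i ≥ 2, X = K_1 × ⋯ × K_n, let δ ≥ 2 and s ∈ {1,…,n} with r := d_s − δ + 1 ≥ 1, and write d = ∑_{i=1}^k (d_i − 1) + ℓ with 0 ≤ k < n and 0 < ℓ ≤ d_{k+1} − 1. Assume that n = k + 1 or 3 ≤ d_1 ≤ ⋯ ≤ d_n, that neither of the following holds: (i) k + 2 ≤ n and d_{k+2} ≤ d_s; (ii) d_s ≤ d_{k+1} and 0 ≤ d_s − (d_{k+1} − ℓ) < r; and that d_s − (d_{k+1} − ℓ) = r. Then W^(1)(D_X^{(δ,s)}(d)) = d_n − ℓ + 1 if n = k + 1, and W^(1)(D_X^{(δ,s)}(d)) = (d_{k+1} − ℓ + 1)(d_{k+2} − 1)·∏_{i=k+3}^n d_i if n > k + 1. -/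

import Mathlib

namespace QACC

open MvPolynomial

noncomputable section

variable {F : Type} [Field F] [Fintype F] [DecidableEq F]

/-- The points of the cartesian set `X = K 0 × ⋯ × K (n-1)`, as a subtype. -/
abbrev cartPoint {n : ℕ} (K : Fin n → Set F) : Type _ :=
  {α : Fin n → F // ∀ i, α i ∈ K i}

noncomputable instance {n : ℕ} (K : Fin n → Set F) : Fintype (cartPoint K) :=
  Fintype.ofFinite _

/-- The evaluation linear map `Ψ` sending a polynomial to its vector of values at points of X. -/
def evalX {n : ℕ} (K : Fin n → Set F) :
    MvPolynomial (Fin n) F →ₗ[F] (cartPoint K → F) where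
  toFun f := fun x => eval x.1 f
  map_add' f g := by funext x; simp
  map_smul' c f := by funext x; simp

/-- The affine cartesian code `C_X(d)`: evaluations of polynomials of total degree `≤ d`. -/
def cartCode {n : ℕ} (K : Fin n → Set F) (d : ℕ) : Submodule F (cartPoint K → F) :=
  (restrictTotalDegree (Fin n) F d).map (evalX K)

/-- The space `P_d^{(δ,s)}` of polynomials of total degree `≤ d` with degree in `X s`
at most `|K s| - δ`. -/
def quasiPoly (n : ℕ) (K : Fin n → Set F) (d δ : ℕ) (s : Fin n) :
    Submodule F (MvPolynomial (Fin n) F) where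
  carrier := {f | f.totalDegree ≤ d ∧ f.degreeOf s ≤ (K s).ncard - δ}
  zero_mem' := by simp
  add_mem' := by
    rintro f g ⟨hf1, hf2⟩ ⟨hg1, hg2⟩
    exact ⟨le_trans (totalDegree_add f g) (max_le hf1 hg1),
      le_trans (degreeOf_add_le s f g) (max_le hf2 hg2)⟩
  smul_mem' := by
    rintro c f ⟨hf1, hf2⟩
    refine ⟨le_trans (totalDegree_smul_le c f) hf1, ?_⟩
    calc (c • f).degreeOf s = (C c * f).degreeOf s := by rw [smul_eq_C_mul]
      _ ≤ (C c).degreeOf s + f.degreeOf s := degreeOf_mul_le s (C c) f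
      _ ≤ (K s).ncard - δ := by simpa [degreeOf_C] using hf2

/-- The `(δ,s)`-quasi affine cartesian code `D_X^{(δ,s)}(d)`. -/
def quasiCode {n : ℕ} (K : Fin n → Set F) (d δ : ℕ) (s : Fin n) :
    Submodule F (cartPoint K → F) :=
  (quasiPoly n K d δ s).map (evalX K)

/-- The minimum distance (minimum Hamming weight of a nonzero codeword) of a linear code. -/
def minDist {ι : Type} [Fintype ι] (C : Submodule F (ι → F)) : ℕ :=
  sInf {w | ∃ v ∈ C, v ≠ 0 ∧ hammingNorm v = w}


/-- Footprint bound: a nonzero polynomial has a monomial `a` such that at least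
`∏ i, (#(S i) - a i)` points of the grid `∏ i, S i` are not zeros. -/
theorem exists_mem_support_prod_le_card_nonzeros {F : Type*} [Field F] [DecidableEq F] :
    ∀ {n : ℕ} (S : Fin n → Finset F) {f : MvPolynomial (Fin n) F}, f ≠ 0 →
      ∃ a ∈ f.support, ∏ i, ((S i).card - a i) ≤
        ((Fintype.piFinset S).filter (fun x => eval x f ≠ 0)).card
  | 0, S, f, hf => by
    obtain ⟨a, ha⟩ := support_nonempty.mpr hf
    refine ⟨a, ha, ?_⟩
    rw [Finset.univ_eq_empty, Finset.prod_empty, Nat.one_le_iff_ne_zero, ← Nat.pos_iff_ne_zero,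
      Finset.card_pos]
    refine ⟨fun i => i.elim0, ?_⟩
    have h := eq_C_of_isEmpty f
    rw [Finset.mem_filter]
    refine ⟨Fintype.mem_piFinset.mpr fun i => i.elim0, ?_⟩
    rw [h, eval_C]
    intro h0
    exact hf (by rw [h, h0, C_0])
  | n + 1, S, f, hf => by
    set p := finSuccEquiv F n f with hp
    have hp0 : p ≠ 0 := by simpa [hp] using hf
    obtain ⟨a, ha, hle⟩ := exists_mem_support_prod_le_card_nonzeros (fun i => S i.succ)
      (Polynomial.leadingCoeff_ne_zero.mpr hp0)
    refine ⟨a.cons p.natDegree, mem_support_coeff_finSuccEquiv.mp ha, ?_⟩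
    set Y := (Fintype.piFinset fun i => S i.succ).filter
      (fun x => eval x p.leadingCoeff ≠ 0) with hY
    have hfib : ∀ y ∈ Y, (S 0).card - p.natDegree ≤
        ((S 0).filter (fun c => eval (Fin.cons c y) f ≠ 0)).card := by
      intro y hy
      have hy0 : eval y p.leadingCoeff ≠ 0 := (Finset.mem_filter.mp hy).2
      have hq0 : p.map (eval y) ≠ 0 := fun h => hy0 (by
        rw [Polynomial.leadingCoeff, ← Polynomial.coeff_map, h, Polynomial.coeff_zero])
      have hroots : ((S 0).filter (fun c => ¬ eval (Fin.cons c y) f ≠ 0)).card ≤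
          p.natDegree := by
        refine le_trans ?_ ((Polynomial.card_roots' _).trans
          (Polynomial.natDegree_map_le (f := eval y) (p := p)))
        refine le_trans (Finset.card_le_card ?_) (Multiset.toFinset_card_le _)
        intro c hc
        rw [Finset.mem_filter, not_not, eval_eq_eval_mv_eval'] at hc
        rw [Multiset.mem_toFinset, Polynomial.mem_roots hq0]
        exact hc.2
      have := Finset.card_filter_add_card_filter_not (s := S 0)
        (fun c => eval (Fin.cons c y : Fin (n + 1) → F) f ≠ 0)
      omega
    rw [Fin.prod_univ_succ]
    simp only [Finsupp.cons_zero, Finsupp.cons_succ]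
    calc ((S 0).card - p.natDegree) * ∏ i : Fin n, ((S i.succ).card - a i)
        ≤ Y.card * ((S 0).card - p.natDegree) := by
          rw [mul_comm]; exact Nat.mul_le_mul_right _ hle
      _ ≤ ∑ y ∈ Y, ((S 0).filter (fun c => eval (Fin.cons c y) f ≠ 0)).card := by
          rw [← smul_eq_mul]; exact Finset.card_nsmul_le_sum _ _ _ hfib
      _ = (Y.sigma fun y => (S 0).filter (fun c => eval (Fin.cons c y) f ≠ 0)).card :=
          (Finset.card_sigma _ _).symm
      _ ≤ _ := by
          refine Finset.card_le_card_of_injOn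
            (fun z => (Fin.cons z.2 z.1 : Fin (n + 1) → F)) ?_ ?_
          · rintro ⟨y, c⟩ hz
            simp only [Finset.coe_sigma, Set.mem_sigma_iff, Finset.mem_coe, Finset.mem_filter,
              Fintype.mem_piFinset, hY] at hz ⊢
            refine ⟨?_, hz.2.2⟩
            intro i
            refine Fin.cases ?_ (fun i => ?_) i
            · exact hz.2.1
            · exact hz.1.1 i
          · rintro ⟨y, c⟩ - ⟨y', c'⟩ - h
            obtain ⟨h1, h2⟩ := Fin.cons_inj.mp h
            subst h1; subst h2; rfl

/-- Over coordinates bounded by values `d i ≥ x`, an extra factor `x` can be moved into the product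
without increasing it, keeping the sum (up to the loss of a `1`) or saturating all the bounds. -/
theorem exists_absorb {ι : Type*} [DecidableEq ι] {H : Finset ι} {d : ι → ℕ} (x : ℕ) :
    ∀ b : ι → ℕ, 1 ≤ x → (∀ i ∈ H, x ≤ d i) → (∀ i ∈ H, 1 ≤ b i ∧ b i ≤ d i) →
      ∃ b' : ι → ℕ, (∀ i ∈ H, 1 ≤ b' i ∧ b' i ≤ d i) ∧ ∏ i ∈ H, b' i ≤ x * ∏ i ∈ H, b i ∧
        (∑ i ∈ H, b i + x ≤ ∑ i ∈ H, b' i + 1 ∨ ∀ i ∈ H, b' i = d i) := by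
  induction x using Nat.strong_induction_on with
  | _ x ih =>
  intro b hx hxd hb
  by_cases hfull : ∀ i ∈ H, b i = d i
  · exact ⟨b, hb, Nat.le_mul_of_pos_left _ hx, Or.inr hfull⟩
  push Not at hfull
  obtain ⟨j, hj, hne⟩ := hfull
  have hlt : b j < d j := lt_of_le_of_ne (hb j hj).2 hne
  have hbj := (hb j hj).1
  have hxj := hxd j hj
  have hbd : ∀ c, 1 ≤ c → c ≤ d j → ∀ i ∈ H,
      1 ≤ Function.update b j c i ∧ Function.update b j c i ≤ d i := by
    intro c hc1 hc i hi
    by_cases h : i = j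
    · subst h; simpa using ⟨hc1, hc⟩
    · simpa [h] using hb i hi
  have hsum := Finset.add_sum_erase H b hj
  have hprod := Finset.mul_prod_erase H b hj
  have hsumu : ∀ c, ∑ i ∈ H, Function.update b j c i = c + ∑ i ∈ H.erase j, b i := by
    intro c
    rw [Finset.sum_update_of_mem hj, Finset.sdiff_singleton_eq_erase]
  have hprodu : ∀ c, ∏ i ∈ H, Function.update b j c i = c * ∏ i ∈ H.erase j, b i := by
    intro c
    rw [Finset.prod_update_of_mem hj, Finset.sdiff_singleton_eq_erase]
  obtain ⟨u, rfl⟩ : ∃ u, x = u + 1 := ⟨x - 1, by omega⟩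
  by_cases hcase : u + b j ≤ d j
  · refine ⟨Function.update b j (u + b j), hbd _ (by omega) hcase, ?_, Or.inl ?_⟩
    · rw [hprodu, ← hprod, ← mul_assoc]
      exact Nat.mul_le_mul_right _ (by nlinarith)
    · rw [hsumu]; omega
  · obtain ⟨y, hy⟩ : ∃ y, u + 1 + b j = d j + y := ⟨u + 1 + b j - d j, by omega⟩
    obtain ⟨b', hb', hle, hor⟩ := ih y (by omega) (Function.update b j (d j)) (by omega)
      (fun i hi => le_trans (by omega) (hxd i hi)) (hbd _ (by omega) le_rfl)
    refine ⟨b', hb', hle.trans ?_, hor.imp_left fun h => ?_⟩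
    · rw [hprodu, ← hprod, ← mul_assoc, ← mul_assoc]
      refine Nat.mul_le_mul_right _ ?_
      obtain ⟨z, hz⟩ : ∃ z, d j = b j + z := ⟨d j - b j, by omega⟩
      obtain ⟨w, hw⟩ : ∃ w, d j = u + 1 + w := ⟨d j - (u + 1), by omega⟩
      have : u + 1 = y + z := by omega
      have : b j = y + w := by omega
      rw [hz, ‹u + 1 = y + z›, ‹b j = y + w›]
      nlinarith [Nat.zero_le (z * w)]
    · rw [hsumu] at h; omega

theorem exists_absorb_prod {ι : Type*} [DecidableEq ι] {H : Finset ι} {d : ι → ℕ}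
    (L : Finset ι) (b : ι → ℕ) (hL : ∀ i ∈ L, 1 ≤ b i ∧ ∀ j ∈ H, b i ≤ d j)
    (hH : ∀ i ∈ H, 1 ≤ b i ∧ b i ≤ d i) :
    ∃ b' : ι → ℕ, (∀ i ∈ H, 1 ≤ b' i ∧ b' i ≤ d i) ∧
      ∏ i ∈ H, b' i ≤ (∏ i ∈ L, b i) * ∏ i ∈ H, b i ∧
      (∑ i ∈ H, b i + ∑ i ∈ L, b i ≤ ∑ i ∈ H, b' i + L.card ∨ ∀ i ∈ H, b' i = d i) := by
  induction L using Finset.induction_on with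
  | empty => exact ⟨b, hH, by simp, Or.inl (by simp)⟩
  | insert j L hj ih =>
    obtain ⟨c, hc, hprod, hsum⟩ := ih fun i hi => hL i (Finset.mem_insert_of_mem hi)
    obtain ⟨hj1, hj2⟩ := hL j (Finset.mem_insert_self _ _)
    obtain ⟨b', hb', hprod', hsum'⟩ := exists_absorb (b j) c hj1 hj2 hc
    rw [Finset.prod_insert hj, Finset.sum_insert hj, Finset.card_insert_of_notMem hj]
    refine ⟨b', hb', ?_, ?_⟩
    · rw [mul_assoc]
      exact hprod'.trans (Nat.mul_le_mul_left _ hprod)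
    · rcases hsum' with h | h
      · rcases hsum with h' | h'
        · left; omega
        · right
          by_contra! hcon
          obtain ⟨i, hi, hne⟩ := hcon
          have : ∑ i ∈ H, b' i < ∑ i ∈ H, c i := by
            refine Finset.sum_lt_sum (fun i hi => ?_)
              ⟨i, hi, ?_⟩
            · rw [h' i hi]; exact (hb' i hi).2
            · rw [h' i hi]; exact lt_of_le_of_ne (hb' i hi).2 hne
          omega
      · exact Or.inr h

/-- A Bernoulli type inequality: a total deficit `t` costs at most a proportion `t / D`. -/
theorem sub_mul_prod_le_mul_prod {ι : Type*} [DecidableEq ι] {H : Finset ι} {d b : ι → ℕ} {D : ℕ}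
    (hD : ∀ i ∈ H, D ≤ d i) (hb : ∀ i ∈ H, b i ≤ d i) (t : ℕ)
    (ht : ∑ i ∈ H, d i ≤ ∑ i ∈ H, b i + t) :
    (D - t) * ∏ i ∈ H, d i ≤ D * ∏ i ∈ H, b i := by
  induction H using Finset.induction_on generalizing t with
  | empty => simp
  | insert j H hj ih =>
    rw [Finset.sum_insert hj, Finset.sum_insert hj] at ht
    rw [Finset.prod_insert hj, Finset.prod_insert hj]
    have hDj := hD j (Finset.mem_insert_self _ _)
    have hbj := hb j (Finset.mem_insert_self _ _)
    have hle : ∑ i ∈ H, b i ≤ ∑ i ∈ H, d i :=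
      Finset.sum_le_sum fun i hi => hb i (Finset.mem_insert_of_mem hi)
    obtain ⟨z, hz⟩ : ∃ z, d j = b j + z := ⟨d j - b j, by omega⟩
    have h := ih (fun i hi => hD i (Finset.mem_insert_of_mem hi))
      (fun i hi => hb i (Finset.mem_insert_of_mem hi)) (t - z) (by omega)
    rcases le_total D t with htD | htD
    · simp [Nat.sub_eq_zero_of_le htD]
    obtain ⟨v, hv⟩ : ∃ v, t = v + z := ⟨t - z, by omega⟩
    obtain ⟨w, hw⟩ : ∃ w, D = t + w := ⟨D - t, by omega⟩
    have e1 : D - t = w := by omega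
    have e2 : D - (t - z) = w + z := by omega
    rw [e1]
    rw [e2] at h
    calc w * (d j * ∏ i ∈ H, d i) = (w * d j) * ∏ i ∈ H, d i := (mul_assoc _ _ _).symm
      _ ≤ ((w + z) * b j) * ∏ i ∈ H, d i := by
          refine Nat.mul_le_mul_right _ ?_
          have : w ≤ b j := by omega
          rw [hz]; nlinarith [Nat.mul_le_mul_right z this]
      _ = b j * ((w + z) * ∏ i ∈ H, d i) := by ring
      _ ≤ b j * (D * ∏ i ∈ H, b i) := Nat.mul_le_mul_left _ h
      _ = D * (b j * ∏ i ∈ H, b i) := by ring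

/-- Minimal product of a box vector with one lower bounded coordinate and prescribed sum. -/
theorem mul_le_prod_of_sum_le {ι : Type*} [DecidableEq ι] {L H : Finset ι} {d b : ι → ℕ}
    {m x j : ℕ} {P : ℕ} (hm : 1 ≤ m) (hx : m + 1 ≤ x) (hxj : x < j)
    (hHj : ∀ i ∈ H, j ≤ d i) (hP : ∏ i ∈ H, d i = j * P)
    (hL : ∀ i ∈ L, 1 ≤ b i ∧ b i ≤ j) (hH : ∀ i ∈ H, 1 ≤ b i ∧ b i ≤ d i)
    (hsum : L.card + m + ∑ i ∈ H, d i ≤ x + ∑ i ∈ L, b i + ∑ i ∈ H, b i) :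
    (m + 1) * (j - 1) * P ≤ x * ((∏ i ∈ L, b i) * ∏ i ∈ H, b i) := by
  obtain ⟨c, hc, hprod, hor⟩ := exists_absorb_prod L b
    (fun i hi => ⟨(hL i hi).1, fun k hk => (hL i hi).2.trans (hHj k hk)⟩) hH
  refine le_trans ?_ (Nat.mul_le_mul_left x hprod)
  have hdef : ∑ i ∈ H, d i ≤ ∑ i ∈ H, c i + (x - m) := by
    rcases hor with h | h
    · omega
    · exact (Finset.sum_congr rfl h).ge.trans (Nat.le_add_right _ _)
  have h := sub_mul_prod_le_mul_prod hHj (fun i hi => (hc i hi).2) _ hdef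
  rw [hP, mul_left_comm] at h
  have h' := Nat.le_of_mul_le_mul_left h (by omega : 0 < j)
  obtain ⟨u, rfl⟩ : ∃ u, x = m + 1 + u := ⟨x - (m + 1), by omega⟩
  obtain ⟨v, rfl⟩ : ∃ v, j = m + 1 + u + 1 + v := ⟨j - (m + 1 + u + 1), by omega⟩
  have e1 : m + 1 + u + 1 + v - (m + 1 + u - m) = m + 1 + v := by omega
  have e2 : m + 1 + u + 1 + v - 1 = m + 1 + u + v := by omega
  rw [e1] at h'
  rw [e2]
  calc (m + 1) * (m + 1 + u + v) * P ≤ ((m + 1 + u) * (m + 1 + v)) * P := by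
        refine Nat.mul_le_mul_right _ ?_
        nlinarith [Nat.zero_le (u * v)]
    _ = (m + 1 + u) * ((m + 1 + v) * P) := mul_assoc _ _ _
    _ ≤ _ := Nat.mul_le_mul_left _ h'

@[to_additive]
theorem prod_univ_eq_mul_prod_filter {M : Type*} [CommMonoid M] {n k : ℕ} {s : Fin n}
    (hs : (s : ℕ) ≤ k) (g : Fin n → M) :
    ∏ i, g i = g s * ((∏ i ∈ Finset.univ.filter (fun i : Fin n => (i : ℕ) ≤ k ∧ i ≠ s), g i) *
      ∏ i ∈ Finset.univ.filter (fun i : Fin n => k + 1 ≤ (i : ℕ)), g i) := by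
  rw [← Finset.mul_prod_erase _ _ (Finset.mem_univ s), ← Finset.prod_union]
  · congr 2
    ext i
    simp only [Finset.mem_erase, Finset.mem_univ, and_true, Finset.mem_union, Finset.mem_filter,
      true_and]
    refine ⟨fun h => ?_, ?_⟩
    · rcases le_or_gt (i : ℕ) k with h' | h'
      · exact Or.inl ⟨h', h⟩
      · exact Or.inr h'
    · rintro (h | h) rfl
      · exact h.2 rfl
      · omega
  · rw [Finset.disjoint_left]
    intro i hi hi'
    simp only [Finset.mem_filter, Finset.mem_univ, true_and] at hi hi'
    omega

theorem add_sum_filter_lt_eq {M : Type*} [AddCommMonoid M] {n k : ℕ} (hk : k < n) {s : Fin n}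
    (hs : (s : ℕ) ≤ k) (g : Fin n → M) :
    g ⟨k, hk⟩ + ∑ i ∈ Finset.univ.filter (fun i : Fin n => (i : ℕ) < k), g i =
      g s + ∑ i ∈ Finset.univ.filter (fun i : Fin n => (i : ℕ) ≤ k ∧ i ≠ s), g i := by
  rw [← Finset.sum_insert (by simp), ← Finset.sum_insert (by simp)]
  congr 1
  ext i
  simp only [Finset.mem_insert, Finset.mem_filter, Finset.mem_univ, true_and, Fin.ext_iff]
  omega

theorem filter_le_eq_insert {n k : ℕ} (hk : k < n) :
    Finset.univ.filter (fun i : Fin n => k ≤ (i : ℕ)) =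
      insert ⟨k, hk⟩ (Finset.univ.filter (fun i : Fin n => k + 1 ≤ (i : ℕ))) := by
  ext i
  simp only [Finset.mem_insert, Finset.mem_filter, Finset.mem_univ, true_and, Fin.ext_iff]
  omega

/-- Exponents can be reduced below `q` on the solutions of `x ^ q = x`. -/
theorem exists_reduced_exponent {F : Type*} [Monoid F] {q : ℕ} (hq : 2 ≤ q) (e : ℕ) :
    ∃ e' ≤ e, e' < q ∧ ∀ x : F, x ^ q = x → x ^ e' = x ^ e := by
  induction e using Nat.strong_induction_on with
  | _ e ih =>
  rcases lt_or_ge e q with h | h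
  · exact ⟨e, le_rfl, h, fun _ _ => rfl⟩
  · obtain ⟨e', h1, h2, h3⟩ := ih (e - q + 1) (by omega)
    refine ⟨e', by omega, h2, fun x hx => ?_⟩
    rw [h3 x hx, pow_succ]
    nth_rw 2 [← hx]
    rw [← pow_add, Nat.sub_add_cancel h]

theorem pow_ncard_of_mem {E : Type} [Field E] [Finite E] {K : Subfield E} {x : E}
    (hx : x ∈ K) : x ^ (K : Set E).ncard = x := by
  have : Fintype K := Fintype.ofFinite _
  have h := FiniteField.pow_card (⟨x, hx⟩ : K)
  rw [← Nat.card_eq_fintype_card] at h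
  exact congrArg Subtype.val h

/-- Every polynomial of `quasiPoly` agrees on the grid with a polynomial supported on reduced
monomials. -/
theorem exists_reduced {E : Type} [Field E] [Finite E] {n : ℕ} {K : Fin n → Subfield E}
    (hK : ∀ i, 2 ≤ (K i : Set E).ncard) {d δ : ℕ} {s : Fin n} {f : MvPolynomial (Fin n) E}
    (hf : f ∈ quasiPoly n (fun i => (K i : Set E)) d δ s) :
    ∃ g : MvPolynomial (Fin n) E, (∀ x : Fin n → E, (∀ i, x i ∈ K i) → eval x g = eval x f) ∧
      ∀ a ∈ g.support, (∀ i, a i < (K i : Set E).ncard) ∧ ∑ i, a i ≤ d ∧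
        a s ≤ (K s : Set E).ncard - δ := by
  choose red hred1 hred2 hred3 using fun i => exists_reduced_exponent (F := E) (hK i)
  let redm : (Fin n →₀ ℕ) → (Fin n →₀ ℕ) :=
    fun a => Finsupp.equivFunOnFinite.symm fun i => red i (a i)
  refine ⟨∑ a ∈ f.support, monomial (redm a) (coeff a f), fun x hx => ?_, fun a ha => ?_⟩
  · rw [map_sum, eval_eq']
    refine Finset.sum_congr rfl fun a _ => ?_
    rw [eval_monomial, Finsupp.prod_fintype _ _ (fun i => pow_zero _)]
    congr 1
    exact Finset.prod_congr rfl fun i _ => hred3 i _ _ (pow_ncard_of_mem (hx i))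
  · obtain ⟨c, hc, hac⟩ := Finset.mem_biUnion.mp (support_sum ha)
    have hac := Finset.mem_singleton.mp (support_monomial_subset hac)
    subst hac
    refine ⟨fun i => hred2 i _, ?_, ?_⟩
    · refine (Finset.sum_le_sum fun i _ => hred1 i (c i)).trans (le_trans ?_ hf.1)
      have := le_totalDegree hc
      rwa [Finsupp.sum_fintype _ _ (fun _ => rfl)] at this
    · exact (hred1 s _).trans ((monomial_le_degreeOf s hc).trans hf.2)

theorem hammingNorm_evalX {n : ℕ} (K : Fin n → Set F) (f : MvPolynomial (Fin n) F) :
    hammingNorm (evalX K f) =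
      ((Fintype.piFinset fun i => (K i).toFinite.toFinset).filter
        (fun x => eval x f ≠ 0)).card := by
  refine Finset.card_bij (fun x _ => x.1) ?_ ?_ ?_
  · intro x hx
    rw [Finset.mem_filter] at hx ⊢
    exact ⟨Fintype.mem_piFinset.mpr fun i => (Set.Finite.mem_toFinset _).mpr (x.2 i), hx.2⟩
  · intro x _ y _ h
    exact Subtype.ext h
  · intro x hx
    rw [Finset.mem_filter, Fintype.mem_piFinset] at hx
    exact ⟨⟨x, fun i => (Set.Finite.mem_toFinset _).mp (hx.1 i)⟩,
      Finset.mem_filter.mpr ⟨Finset.mem_univ _, hx.2⟩, rfl⟩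

theorem exists_prod_le_hammingNorm {n : ℕ} {K : Fin n → Subfield F}
    (hK : ∀ i, 2 ≤ (K i : Set F).ncard) {d δ : ℕ} {s : Fin n}
    {v : cartPoint (fun i => (K i : Set F)) → F}
    (hv : v ∈ quasiCode (fun i => (K i : Set F)) d δ s) (hv0 : v ≠ 0) :
    ∃ a : Fin n → ℕ, (∀ i, a i < (K i : Set F).ncard) ∧ ∑ i, a i ≤ d ∧
      a s ≤ (K s : Set F).ncard - δ ∧ ∏ i, ((K i : Set F).ncard - a i) ≤ hammingNorm v := by
  obtain ⟨f, hf, rfl⟩ := hv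
  obtain ⟨g, hgf, hg⟩ := exists_reduced hK hf
  have heq : evalX (fun i => (K i : Set F)) g = evalX (fun i => (K i : Set F)) f :=
    funext fun x => hgf x.1 x.2
  rw [← heq] at hv0 ⊢
  obtain ⟨a, ha, hle⟩ := exists_mem_support_prod_le_card_nonzeros
    (fun i => (K i : Set F).toFinite.toFinset) (f := g) (fun h => hv0 (by rw [h, map_zero]))
  refine ⟨a, (hg a ha).1, (hg a ha).2.1, (hg a ha).2.2, ?_⟩
  rw [hammingNorm_evalX]
  simpa only [Set.ncard_eq_toFinset_card _ (Set.toFinite _)] using hle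

theorem exists_hammingNorm_eq_prod {n : ℕ} (K : Fin n → Set F) {d δ : ℕ} {s : Fin n}
    {a : Fin n → ℕ} (ha : ∀ i, a i < (K i).ncard) (had : ∑ i, a i ≤ d)
    (has : a s ≤ (K s).ncard - δ) :
    ∃ v ∈ quasiCode K d δ s, v ≠ 0 ∧ hammingNorm v = ∏ i, ((K i).ncard - a i) := by
  have hT : ∀ i, ∃ T ⊆ (K i).toFinite.toFinset, T.card = a i := fun i =>
    Finset.exists_subset_card_eq (by
      rw [← Set.ncard_eq_toFinset_card]; exact (ha i).le)
  choose T hTK hTc using hT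
  let f : MvPolynomial (Fin n) F := ∏ i, ∏ c ∈ T i, (X i - C c)
  have hXdeg : ∀ i (c : F), (X i - C c : MvPolynomial (Fin n) F).totalDegree ≤ 1 := fun i c =>
    (totalDegree_sub_C_le _ _).trans (totalDegree_X i).le
  have hXs : ∀ i (c : F),
      (X i - C c : MvPolynomial (Fin n) F).degreeOf s ≤ if i = s then 1 else 0 := by
    intro i c
    refine (degreeOf_sub_le s _ _).trans ?_
    rw [degreeOf_C, degreeOf_X]
    by_cases h : i = s
    · simp [h]
    · simp [h, Ne.symm h]
  have hf : f ∈ quasiPoly n K d δ s := by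
    constructor
    · refine le_trans ?_ had
      refine (totalDegree_finsetProd _ _).trans (Finset.sum_le_sum fun i _ => ?_)
      refine (totalDegree_finsetProd _ _).trans ?_
      refine (Finset.sum_le_card_nsmul _ _ 1 fun c _ => hXdeg i c).trans ?_
      simp [hTc]
    · refine le_trans ?_ has
      refine (degreeOf_prod_le s _ _).trans ?_
      calc ∑ i, degreeOf s (∏ c ∈ T i, (X i - C c : MvPolynomial (Fin n) F))
          ≤ ∑ i, if i = s then a i else 0 := by
            refine Finset.sum_le_sum fun i _ => ?_
            refine (degreeOf_prod_le s _ _).trans ?_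
            refine (Finset.sum_le_card_nsmul _ _ _ fun c _ => hXs i c).trans ?_
            rw [hTc]
            split_ifs <;> simp
        _ = a s := by simp
  have hw : hammingNorm (evalX K f) = ∏ i, ((K i).ncard - a i) := by
    rw [hammingNorm_evalX]
    have : (Fintype.piFinset fun i => (K i).toFinite.toFinset).filter (fun x => eval x f ≠ 0) =
        Fintype.piFinset fun i => (K i).toFinite.toFinset \ T i := by
      ext x
      simp only [f, Finset.mem_filter, Fintype.mem_piFinset, map_prod, map_sub, eval_X, eval_C,
        Finset.prod_ne_zero_iff, Finset.mem_univ, true_implies, Finset.mem_sdiff, sub_ne_zero,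
        ← forall_and]
      refine forall_congr' fun i => and_congr_right fun _ => ?_
      exact ⟨fun h hx => h _ hx rfl, fun h c hc hxc => h (hxc ▸ hc)⟩
    rw [this, Fintype.card_piFinset]
    refine Finset.prod_congr rfl fun i _ => ?_
    rw [Finset.card_sdiff_of_subset (hTK i), hTc, ← Set.ncard_eq_toFinset_card]
  refine ⟨_, Submodule.mem_map_of_mem hf, fun h0 => ?_, hw⟩
  rw [h0, hammingNorm_zero] at hw
  exact (Finset.prod_pos fun i _ => Nat.sub_pos_of_lt (ha i)).ne hw

/-- The minimum distance of a quasi affine cartesian code over subfields is given by the footprint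
bound. -/
theorem minDist_quasiCode_eq {n : ℕ} {K : Fin n → Subfield F}
    (hK : ∀ i, 2 ≤ (K i : Set F).ncard) {d δ : ℕ} {s : Fin n} {N : ℕ}
    (hex : ∃ a : Fin n → ℕ, (∀ i, a i < (K i : Set F).ncard) ∧ ∑ i, a i ≤ d ∧
      a s ≤ (K s : Set F).ncard - δ ∧ ∏ i, ((K i : Set F).ncard - a i) = N)
    (hle : ∀ a : Fin n → ℕ, (∀ i, a i < (K i : Set F).ncard) → ∑ i, a i ≤ d →
      a s ≤ (K s : Set F).ncard - δ → N ≤ ∏ i, ((K i : Set F).ncard - a i)) :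
    minDist (quasiCode (fun i => (K i : Set F)) d δ s) = N := by
  obtain ⟨a, h1, h2, h3, rfl⟩ := hex
  obtain ⟨v, hv, hv0, hw⟩ :=
    exists_hammingNorm_eq_prod (fun i => (K i : Set F)) (s := s) h1 h2 h3
  apply le_antisymm
  · exact Nat.sInf_le ⟨v, hv, hv0, hw⟩
  · refine le_csInf ⟨_, v, hv, hv0, hw⟩ ?_
    rintro w ⟨u, hu, hu0, rfl⟩
    obtain ⟨b, hb1, hb2, hb3, hbw⟩ := exists_prod_le_hammingNorm hK hu hu0
    exact (hle b hb1 hb2 hb3).trans hbw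

/-- for a chain of subfields, assume n = k + 1 or all d_i ≥ 3, that neither
condition (i) (k + 2 ≤ n and d_{k+2} ≤ d_s) nor condition (ii) (d_s ≤ d_{k+1} and
0 ≤ d_s - (d_{k+1} - ℓ) < r) holds, and that d_s - (d_{k+1} - ℓ) = r.  Then
W¹(D_X^{(δ,s)}(d)) = d_n - ℓ + 1 if n = k + 1, and
W¹(D_X^{(δ,s)}(d)) = (d_{k+1} - ℓ + 1)(d_{k+2} - 1)∏_{i=k+3}^n d_i if n > k + 1.
(0-based indices.) -/
theorem minDist_quasiCode_next_to_minimal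
    (n : ℕ) (K : Fin n → Subfield F) (hmono : Monotone K)
    (hK : ∀ i, 2 ≤ ((K i : Set F)).ncard)
    (δ : ℕ) (hδ : 2 ≤ δ) (s : Fin n) (hδs : δ ≤ ((K s : Set F)).ncard)
    (r : ℕ) (hrdef : r = ((K s : Set F)).ncard - δ + 1)
    (d k ℓ : ℕ) (hk : k < n)
    (hd : d = (∑ i ∈ Finset.univ.filter (fun i : Fin n => (i : ℕ) < k),
        (((K i : Set F)).ncard - 1)) + ℓ)
    (hℓ1 : 0 < ℓ) (hℓ2 : ℓ ≤ ((K ⟨k, hk⟩ : Set F)).ncard - 1)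
    (hcube : n = k + 1 ∨ ∀ i, 3 ≤ ((K i : Set F)).ncard)
    (hnoti : ¬ ∃ hk2 : k + 1 < n, ((K ⟨k + 1, hk2⟩ : Set F)).ncard ≤ ((K s : Set F)).ncard)
    (hnotii : ¬ (((K s : Set F)).ncard ≤ ((K ⟨k, hk⟩ : Set F)).ncard ∧
      ((K ⟨k, hk⟩ : Set F)).ncard - ℓ ≤ ((K s : Set F)).ncard ∧
      ((K s : Set F)).ncard - (((K ⟨k, hk⟩ : Set F)).ncard - ℓ) < r))
    (heq : ((K ⟨k, hk⟩ : Set F)).ncard - ℓ ≤ ((K s : Set F)).ncard ∧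
      ((K s : Set F)).ncard - (((K ⟨k, hk⟩ : Set F)).ncard - ℓ) = r) :
    (n = k + 1 →
      minDist (quasiCode (fun i => (K i : Set F)) d δ s) =
        ((K ⟨n - 1, by omega⟩ : Set F)).ncard - ℓ + 1) ∧
    (∀ hk2 : k + 1 < n,
      minDist (quasiCode (fun i => (K i : Set F)) d δ s) =
        (((K ⟨k, hk⟩ : Set F)).ncard - ℓ + 1) * (((K ⟨k + 1, hk2⟩ : Set F)).ncard - 1) *
          ∏ i ∈ Finset.univ.filter (fun i : Fin n => k + 2 ≤ (i : ℕ)),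
            ((K i : Set F)).ncard) := by
  have hc : ∀ i j : Fin n, i ≤ j → (K i : Set F).ncard ≤ (K j : Set F).ncard := fun i j h =>
    Set.ncard_le_ncard (hmono h) (Set.toFinite _)
  have hsk : (s : ℕ) ≤ k := by
    by_contra! h
    exact hnoti ⟨by omega, hc _ _ (Fin.le_def.mpr h)⟩
  have hsplit := add_sum_filter_lt_eq hk hsk fun i => (K i : Set F).ncard - 1
  set L := Finset.univ.filter (fun i : Fin n => (i : ℕ) ≤ k ∧ i ≠ s) with hLdef
  set H := Finset.univ.filter (fun i : Fin n => k + 1 ≤ (i : ℕ)) with hHdef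
  have hmemL : ∀ i ∈ L, (i : ℕ) ≤ k ∧ i ≠ s := fun i hi => (Finset.mem_filter.mp hi).2
  have hmemH : ∀ i ∈ H, k + 1 ≤ (i : ℕ) := fun i hi => (Finset.mem_filter.mp hi).2
  obtain ⟨m, hm⟩ : ∃ m, m = (K ⟨k, hk⟩ : Set F).ncard - ℓ := ⟨_, rfl⟩
  rw [← hm] at heq ⊢
  have hKs := hK s
  have hKk := hK ⟨k, hk⟩
  have hδm : δ = m + 1 := by omega
  have hcardL : ∑ i ∈ L, ((K i : Set F).ncard - 1) + L.card = ∑ i ∈ L, (K i : Set F).ncard := by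
    rw [Finset.card_eq_sum_ones, ← Finset.sum_add_distrib]
    exact Finset.sum_congr rfl fun i _ => by have := hK i; omega
  let a : ℕ → Fin n → ℕ := fun t i => if i = s then (K s : Set F).ncard - δ else
    if (i : ℕ) ≤ k then (K i : Set F).ncard - 1 else if (i : ℕ) = k + 1 then t else 0
  have has : ∀ t, a t s = (K s : Set F).ncard - δ := fun t => if_pos rfl
  have haL : ∀ t, ∀ i ∈ L, a t i = (K i : Set F).ncard - 1 := fun t i hi => by
    simp [a, hmemL i hi]
  have halt : ∀ i, a 1 i < (K i : Set F).ncard := fun i => by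
    have := hK i
    simp only [a]
    split_ifs with h <;> first | (subst h; omega) | omega
  refine ⟨fun hn => ?_, fun hk2 => ?_⟩
  · subst hn
    have hH : H = ∅ := Finset.filter_eq_empty_iff.mpr fun i _ => by omega
    have hlast : (K ⟨k + 1 - 1, by omega⟩ : Set F).ncard = (K ⟨k, hk⟩ : Set F).ncard := rfl
    rw [hlast, ← hm]
    refine minDist_quasiCode_eq hK ⟨a 1, halt, ?_, (has 1).le, ?_⟩ fun b hb hbd hbs => ?_
    · rw [sum_univ_eq_add_sum_filter hsk, ← hLdef, ← hHdef, hH, Finset.sum_empty, has,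
        Finset.sum_congr rfl (haL 1)]
      omega
    · rw [prod_univ_eq_mul_prod_filter hsk, ← hLdef, ← hHdef, hH, Finset.prod_empty, has,
        Finset.prod_eq_one fun i hi => by rw [haL 1 i hi]; have := hK i; omega]
      omega
    · rw [prod_univ_eq_mul_prod_filter hsk]
      refine le_trans (by omega) (Nat.le_mul_of_pos_right _ (Nat.mul_pos ?_ ?_)) <;>
        exact Finset.prod_pos fun i _ => Nat.sub_pos_of_lt (hb i)
  · have hHins : H = insert ⟨k + 1, hk2⟩ (Finset.univ.filter fun i : Fin n => k + 2 ≤ (i : ℕ)) :=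
      filter_le_eq_insert hk2
    have hnot : (⟨k + 1, hk2⟩ : Fin n) ∉ Finset.univ.filter fun i : Fin n => k + 2 ≤ (i : ℕ) := by
      simp
    have hsj : (K s : Set F).ncard < (K ⟨k + 1, hk2⟩ : Set F).ncard := by
      by_contra! h
      exact hnoti ⟨hk2, h⟩
    have hsne : (⟨k + 1, hk2⟩ : Fin n) ≠ s := by
      rintro rfl
      exact lt_irrefl _ hsj
    have haj : a 1 ⟨k + 1, hk2⟩ = 1 := by simp [a, hsne]
    have haH : ∀ i ∈ Finset.univ.filter (fun i : Fin n => k + 2 ≤ (i : ℕ)), a 1 i = 0 := by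
      intro i hi
      have hi := (Finset.mem_filter.mp hi).2
      have h1 : i ≠ s := by rintro rfl; omega
      have h2 : ¬ (i : ℕ) ≤ k := by omega
      have h3 : ¬ (i : ℕ) = k + 1 := by omega
      simp [a, h1, h2, h3]
    refine minDist_quasiCode_eq hK ⟨a 1, halt, ?_, (has 1).le, ?_⟩ fun b hb hbd hbs => ?_
    · rw [sum_univ_eq_add_sum_filter hsk, ← hLdef, ← hHdef, hHins, Finset.sum_insert hnot, has,
        haj, Finset.sum_congr rfl (haL 1), Finset.sum_eq_zero haH]
      omega
    · rw [prod_univ_eq_mul_prod_filter hsk, ← hLdef, ← hHdef, hHins, Finset.prod_insert hnot, has,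
        haj, Finset.prod_eq_one fun i hi => by rw [haL 1 i hi]; have := hK i; omega, one_mul,
        mul_assoc, Finset.prod_congr rfl fun i hi => by rw [haH i hi, Nat.sub_zero]]
      congr 1
      omega
    · rw [prod_univ_eq_mul_prod_filter hsk, ← hLdef, ← hHdef]
      rw [sum_univ_eq_add_sum_filter hsk, ← hLdef, ← hHdef] at hbd
      have hsub : ∀ S : Finset (Fin n), ∑ i ∈ S, ((K i : Set F).ncard - b i) + ∑ i ∈ S, b i =
          ∑ i ∈ S, (K i : Set F).ncard := fun S => by
        rw [← Finset.sum_add_distrib]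
        exact Finset.sum_congr rfl fun i _ => by have := hb i; omega
      have hsubL := hsub L
      have hsubH := hsub H
      have hbs' := hb s
      refine mul_le_prod_of_sum_le (d := fun i => (K i : Set F).ncard) (by omega) (by omega)
        (by omega) (fun i hi => hc _ _ (Fin.le_def.mpr (hmemH i hi))) ?_ (fun i hi => ?_)
        (fun i _ => ?_) ?_
      · rw [hHins, Finset.prod_insert hnot]
      · have h1 := hc i ⟨k + 1, hk2⟩ (Fin.le_def.mpr ((hmemL i hi).1.trans (Nat.le_succ k)))
        have h2 := hb i
        omega
      · have h2 := hb i
        omega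
      · omega

end
end QACC
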